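/- Involution preservation of the semi-implicit vorticity scheme (finite difference realization of the theorem on well-prepared data): let ν ≥ 0 and Δt > 0, and let ω : ℕ → (ℤ³ → ℝ³) and E : ℕ → (ℤ³ → ℝ³) satisfy, for every n ∈ ℕ and every grid point i ∈ ℤ³, the update relation ω^{n+1}(i) + ν Δt (curl_h (curl_h ω^{n+1}))(i) = ω^n(i) + Δt (curl_h E^n)(i). If the initial data are well prepared, i.e. (div_h ω⁰)(i) = 0 for all i ∈ ℤ³, then (div_h ω^n)(i) = 0 for all n ∈ ℕ and all i ∈ ℤ³. -/

import Mathlib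

/-- Averaged central difference operator in direction `β` on mesh with sizes `h`. -/
noncomputable def dOp (h : Fin 3 → ℝ) (β : Fin 3) (f : (Fin 3 → ℤ) → ℝ)
    (i : Fin 3 → ℤ) : ℝ :=
  (f (i + Pi.single β 1) - f (i - Pi.single β 1)) / (2 * h β)

/-- Discrete divergence of a discrete vector field. -/
noncomputable def divOp (h : Fin 3 → ℝ) (q : (Fin 3 → ℤ) → Fin 3 → ℝ)
    (i : Fin 3 → ℤ) : ℝ :=
  dOp h 0 (fun j => q j 0) i + dOp h 1 (fun j => q j 1) i + dOp h 2 (fun j => q j 2) i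

/-- Discrete curl of a discrete vector field. -/
noncomputable def curlOp (h : Fin 3 → ℝ) (q : (Fin 3 → ℤ) → Fin 3 → ℝ)
    (i : Fin 3 → ℤ) : Fin 3 → ℝ :=
  ![dOp h 1 (fun j => q j 2) i - dOp h 2 (fun j => q j 1) i,
    dOp h 2 (fun j => q j 0) i - dOp h 0 (fun j => q j 2) i,
    dOp h 0 (fun j => q j 1) i - dOp h 1 (fun j => q j 0) i]

theorem dOp_comm (h : Fin 3 → ℝ) (β γ : Fin 3) (f : (Fin 3 → ℤ) → ℝ) (i : Fin 3 → ℤ) :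
    dOp h β (dOp h γ f) i = dOp h γ (dOp h β f) i := by
  simp only [dOp, sub_eq_add_neg, add_right_comm i]
  ring

theorem dOp_sub (h : Fin 3 → ℝ) (β : Fin 3) (f g : (Fin 3 → ℤ) → ℝ) (i : Fin 3 → ℤ) :
    dOp h β (fun j => f j - g j) i = dOp h β f i - dOp h β g i := by
  simp only [dOp]
  ring

theorem divOp_curlOp (h : Fin 3 → ℝ) (q : (Fin 3 → ℤ) → Fin 3 → ℝ) (i : Fin 3 → ℤ) :
    divOp h (curlOp h q) i = 0 := by
  simp only [divOp, curlOp, Matrix.cons_val, dOp_sub]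
  linarith [dOp_comm h 0 1 (fun j => q j 2) i, dOp_comm h 0 2 (fun j => q j 1) i,
    dOp_comm h 1 2 (fun j => q j 0) i]

theorem divOp_add_smul (h : Fin 3 → ℝ) (c : ℝ) (p q : (Fin 3 → ℤ) → Fin 3 → ℝ)
    (i : Fin 3 → ℤ) :
    divOp h (fun j τ => p j τ + c * q j τ) i = divOp h p i + c * divOp h q i := by
  simp only [divOp, dOp]
  ring

/-- Involution preservation of the semi-implicit vorticity scheme: well-prepared
(divergence-free) initial data stay divergence-free for all time steps. -/
theorem scheme_preserves_involution (h : Fin 3 → ℝ) (hpos : ∀ β, 0 < h β)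
    (ν Δt : ℝ) (hν : 0 ≤ ν) (hΔt : 0 < Δt)
    (ω E : ℕ → (Fin 3 → ℤ) → Fin 3 → ℝ)
    (hupd : ∀ n (i : Fin 3 → ℤ) (τ : Fin 3),
      ω (n + 1) i τ + ν * Δt * curlOp h (curlOp h (ω (n + 1))) i τ
        = ω n i τ + Δt * curlOp h (E n) i τ)
    (h0 : ∀ i, divOp h (ω 0) i = 0) :
    ∀ n i, divOp h (ω n) i = 0 := by
  intro n
  induction n with
  | zero => exact h0
  | succ n ih =>
    intro i
    have hdiv := congrArg (fun q => divOp h q i) (funext fun j => funext fun τ => hupd n j τ)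
    simpa only [divOp_add_smul, divOp_curlOp, ih i, mul_zero, add_zero] using hdiv
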